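/- Let d≥2, β≥0, μ>0, γ>-1 and α=β+μ+(d-1)/2. There exists a constant c>0 depending only on β, γ, μ and d such that for every measurable g:𝕌₀×𝕌→ℝ with g((√t,t),·)∈L¹(𝕌;U_{γ,α}(z)dz) for each t∈[0,1], and for every (x,t)∈𝕍^{d+1} with t>0: ∫_{𝕍^{d+1}} |T_{β,γ,μ}g((x,t),(y,s))|·W_{β,γ,μ}(y,s) dy ds ≤ c·∫_𝕌 |g((√t,t),z)|·U_{γ,α}(z) dz. -/

import Mathlib

open MeasureTheory Real Filter Set
open scoped RealInnerProductSpace ENNReal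

noncomputable section

/-- Pochhammer symbol `(a)_n = a(a+1)⋯(a+n-1)`. -/
def poch (a : ℝ) (n : ℕ) : ℝ := ∏ i ∈ Finset.range n, (a + i)

/-- Jacobi polynomial `P_n^{(a,b)}(t)` via its hypergeometric expansion. -/
def jacobiP (n : ℕ) (a b : ℝ) (t : ℝ) : ℝ :=
  (poch (a + 1) n / (n.factorial : ℝ)) *
    ∑ j ∈ Finset.range (n + 1),
      (poch (-(n : ℝ)) j * poch ((n : ℝ) + a + b + 1) j) /
        (poch (a + 1) j * (j.factorial : ℝ)) * ((1 - t) / 2) ^ j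

/-- Squared norm `h_n^{(a,b)}` of the Jacobi polynomials. -/
def hJ (n : ℕ) (a b : ℝ) : ℝ :=
  (poch (a + 1) n * poch (b + 1) n * (a + b + (n : ℝ) + 1)) /
    ((n.factorial : ℝ) * poch (a + b + 2) n * (a + b + 2 * (n : ℝ) + 1))

/-- Normalization constant `c_{a,b}` of the Jacobi weight. -/
def cJ (a b : ℝ) : ℝ := Real.Gamma (a + b + 2) / (Real.Gamma (a + 1) * Real.Gamma (b + 1))

/-- Generalized binomial coefficient `C(n+δ, n) = (δ+1)_n/n!`. -/
def binomC (δ : ℝ) (n : ℕ) : ℝ := poch (δ + 1) n / (n.factorial : ℝ)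

/-- The parabolic domain `𝕌 = {(x₁,x₂) : x₁² ≤ x₂ ≤ 1}`. -/
def Udom : Set (ℝ × ℝ) := {x | x.1 ^ 2 ≤ x.2 ∧ x.2 ≤ 1}

/-- The curved part `𝕌₀` of the boundary of `𝕌`. -/
def Udom0 : Set (ℝ × ℝ) := {x ∈ Udom | x.2 = x.1 ^ 2}

/-- The weight `U_{a,b}` on the parabolic domain. -/
def Uw (a b : ℝ) (x : ℝ × ℝ) : ℝ := (1 - x.2) ^ a * (x.2 - x.1 ^ 2) ^ (b - 1/2)

/-- Normalization constant `d_{a,b}` of `U_{a,b}`. -/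
def dU (a b : ℝ) : ℝ := (∫ x in Udom, Uw a b x)⁻¹

/-- The weighted measure `U_{a,b}(x) dx` on `𝕌`. -/
def μU (a b : ℝ) : Measure (ℝ × ℝ) :=
  (volume.restrict Udom).withDensity fun x => ENNReal.ofReal (Uw a b x)

/-- The orthogonal basis `P_{k,n}^{a,b}` on the parabolic domain (with the continuous
extension to `x₂ = 0`, where in Lean `x₁/√x₂ = 0` and `(√x₂)^k = 0` for `k ≥ 1`). -/
def PknU (a b : ℝ) (k n : ℕ) (x : ℝ × ℝ) : ℝ :=
  jacobiP (n - k) (b + (k : ℝ)) a (1 - 2 * x.2) * (Real.sqrt x.2) ^ k *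
    jacobiP k (b - 1/2) (b - 1/2) (x.1 / Real.sqrt x.2)

/-- Squared norms `h_{k,n}^{a,b}`. -/
def hknU (a b : ℝ) (k n : ℕ) : ℝ :=
  (cJ b a / cJ (b + (k : ℝ)) a) * hJ (n - k) (b + (k : ℝ)) a * hJ k (b - 1/2) (b - 1/2)

/-- Reproducing kernel `P_n(U_{a,b}; x, y)` on the parabolic domain. -/
def PnU (a b : ℝ) (n : ℕ) (x y : ℝ × ℝ) : ℝ :=
  ∑ k ∈ Finset.range (n + 1), PknU a b k n x * PknU a b k n y / hknU a b k n

/-- Partial-sum kernel `K_n(U_{a,b}; x, y)`. -/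
def KnU (a b : ℝ) (n : ℕ) (x y : ℝ × ℝ) : ℝ :=
  ∑ m ∈ Finset.range (n + 1), PnU a b m x y

/-- Cesàro `(C,δ)` kernel `K_n^δ(U_{a,b}; x, y)`. -/
def KnUCes (a b δ : ℝ) (n : ℕ) (x y : ℝ × ℝ) : ℝ :=
  (binomC δ n)⁻¹ * ∑ m ∈ Finset.range (n + 1), binomC (δ - 1) (n - m) * KnU a b m x y

/-- Cesàro `(C,δ)` means `S_n^δ(U_{a,b}; f, x)`. -/
def SnUCes (a b δ : ℝ) (n : ℕ) (f : ℝ × ℝ → ℝ) (x : ℝ × ℝ) : ℝ :=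
  dU a b * ∫ y in Udom, f y * KnUCes a b δ n x y * Uw a b y

/-- `Z_m^λ`, the normalized Gegenbauer polynomial (`2T_m` in the limiting case `λ = 0`). -/
def Zm (lam : ℝ) (m : ℕ) (t : ℝ) : ℝ :=
  if lam = 0 then (if m = 0 then 1 else 2 * (Polynomial.Chebyshev.T ℝ (m : ℤ)).eval t)
  else ((m : ℝ) + lam) / lam * (poch (2 * lam) m / poch (lam + 1/2) m) *
    jacobiP m (lam - 1/2) (lam - 1/2) t

/-- Euclidean space `ℝ^d`. -/
abbrev Euc (d : ℕ) := EuclideanSpace ℝ (Fin d)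

/-- The surface measure on the unit sphere `𝕊^{d-1}`. -/
def sphMeas (d : ℕ) : Measure (Metric.sphere (0 : Euc d) 1) :=
  (volume : Measure (Euc d)).toSphere

/-- The surface area `ω_d` of the unit sphere. -/
def ωd (d : ℕ) : ℝ := (sphMeas d Set.univ).toReal

/-- Integral over the unit sphere. -/
def sphInt (d : ℕ) (f : Euc d → ℝ) : ℝ := ∫ ξ, f (ξ : Euc d) ∂(sphMeas d)

/-- Integral over the surface of the paraboloid `𝕍₀^{d+1}`:
`∫_{𝕍₀} f dσ = ∫_0^1 t^{(d-1)/2} ∫_{𝕊^{d-1}} f(√t ξ, t) dσ_𝕊(ξ) dt`. -/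
def V0Int (d : ℕ) (f : Euc d → ℝ → ℝ) : ℝ :=
  ∫ t in (0:ℝ)..1, t ^ (((d : ℝ) - 1) / 2) * ∫ ξ, f (Real.sqrt t • (ξ : Euc d)) t ∂(sphMeas d)

/-- The weight `ϖ_{β,γ}(t) = t^β (1-t)^γ`. -/
def wt (β γ : ℝ) (t : ℝ) : ℝ := t ^ β * (1 - t) ^ γ

/-- Normalization constant `b_{β,γ}` on the surface of the paraboloid. -/
def bV0 (d : ℕ) (β γ : ℝ) : ℝ := (V0Int d fun _ t => wt β γ t)⁻¹

/-- The surface of the paraboloid `𝕍₀^{d+1} = {(x,t) : ‖x‖² = t ≤ 1}`. -/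
def V0set (d : ℕ) : Set (Euc d × ℝ) := {q | ‖q.1‖ ^ 2 = q.2 ∧ q.2 ≤ 1}

/-- The weighted measure `ϖ_{β,γ} dσ` on (the sphere-parametrization of) `𝕍₀^{d+1}`. -/
def μV0 (d : ℕ) (β γ : ℝ) : Measure (Metric.sphere (0 : Euc d) 1 × ℝ) :=
  ((sphMeas d).prod (volume.restrict (Set.Icc (0:ℝ) 1))).withDensity
    fun p => ENNReal.ofReal (p.2 ^ (((d : ℝ) - 1) / 2) * wt β γ p.2)

/-- Squared norms `h_{m,n}^{β,γ}` on the surface of the paraboloid. -/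
def hV0 (d : ℕ) (β γ : ℝ) (m n : ℕ) : ℝ :=
  (cJ (β + ((d : ℝ) - 1) / 2) γ / cJ ((m : ℝ) + β + ((d : ℝ) - 1) / 2) γ) *
    hJ (n - m) ((m : ℝ) + β + ((d : ℝ) - 1) / 2) γ

/-- The reproducing kernel `P_n(ϖ_{β,γ}; (√t ξ, t), (√s η, s))` on `𝕍₀^{d+1}`,
written as a function of `t`, `s` and `c = ⟨ξ,η⟩`. -/
def PnV0 (d : ℕ) (β γ : ℝ) (n : ℕ) (t s c : ℝ) : ℝ :=
  ∑ m ∈ Finset.range (n + 1),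
    jacobiP (n - m) ((m : ℝ) + β + ((d : ℝ) - 1) / 2) γ (1 - 2 * t) *
      jacobiP (n - m) ((m : ℝ) + β + ((d : ℝ) - 1) / 2) γ (1 - 2 * s) / hV0 d β γ m n *
      (Real.sqrt t) ^ m * (Real.sqrt s) ^ m * Zm (((d : ℝ) - 2) / 2) m c

/-- Partial-sum kernel `K_n(ϖ_{β,γ})` on `𝕍₀^{d+1}`. -/
def KnV0 (d : ℕ) (β γ : ℝ) (n : ℕ) (t s c : ℝ) : ℝ :=
  ∑ m ∈ Finset.range (n + 1), PnV0 d β γ m t s c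

/-- Cesàro `(C,δ)` kernel on `𝕍₀^{d+1}`. -/
def KnV0Ces (d : ℕ) (β γ δ : ℝ) (n : ℕ) (t s c : ℝ) : ℝ :=
  (binomC δ n)⁻¹ * ∑ m ∈ Finset.range (n + 1), binomC (δ - 1) (n - m) * KnV0 d β γ m t s c

/-- Cesàro `(C,δ)` means `S_n^δ(ϖ_{β,γ}; f, (√t ξ, t))` on `𝕍₀^{d+1}`. -/
def SnV0Ces (d : ℕ) (β γ δ : ℝ) (n : ℕ) (f : Euc d × ℝ → ℝ) (ξ : Euc d) (t : ℝ) : ℝ :=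
  bV0 d β γ * ∫ s in (0:ℝ)..1, s ^ (((d : ℝ) - 1) / 2) * wt β γ s *
    ∫ η, f (Real.sqrt s • (η : Euc d), s) * KnV0Ces d β γ δ n t s ⟪ξ, (η : Euc d)⟫ ∂(sphMeas d)

/-- Normalization constant `τ_β` in the definition of `T_{β,γ}`. -/
def τβ (d : ℕ) (β : ℝ) : ℝ :=
  (∫ z₁ in (-1:ℝ)..1, ∫ z₂ in (-1:ℝ)..1,
    (1 - z₁) ^ (((d : ℝ) - 2) / 2) * (1 + z₁) ^ (β - 1/2) * (1 - z₂ ^ 2) ^ β)⁻¹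

/-- The operator `T_{β,γ}` on the surface of the paraboloid, with
`(x,t) = (√t ξ, t)` and `(y,s) = (√s η, s)`. -/
def TV0 (d : ℕ) (β γ : ℝ) (g : ℝ × ℝ → ℝ × ℝ → ℝ) (ξ η : Euc d) (t s : ℝ) : ℝ :=
  if β = -(1/2) then g (Real.sqrt t, t) (⟪ξ, Real.sqrt s • η⟫, s)
  else τβ d β * ∫ z₁ in (-1:ℝ)..1, ∫ z₂ in (-1:ℝ)..1,
    g (Real.sqrt t, t) (Real.sqrt s * ((1 - z₁) / 2 * ⟪ξ, η⟫ + (1 + z₁) / 2 * z₂), s) *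
      ((1 - z₁) ^ (((d : ℝ) - 2) / 2) * (1 + z₁) ^ (β - 1/2) * (1 - z₂ ^ 2) ^ β)

/-- The pseudo convolution `f ∗_{𝕍₀} g` on the surface of the paraboloid. -/
def convV0 (d : ℕ) (β γ : ℝ) (f : Euc d × ℝ → ℝ) (g : ℝ × ℝ → ℝ × ℝ → ℝ)
    (η : Euc d) (s : ℝ) : ℝ :=
  bV0 d β γ * ∫ t in (0:ℝ)..1, t ^ (((d : ℝ) - 1) / 2) * wt β γ t *
    ∫ ξ, f (Real.sqrt t • (ξ : Euc d), t) * TV0 d β γ g (ξ : Euc d) η t s ∂(sphMeas d)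

/-- The solid paraboloid `𝕍^{d+1} = {(x,t) : ‖x‖² ≤ t ≤ 1}`. -/
def Vset (d : ℕ) : Set (Euc d × ℝ) := {q | ‖q.1‖ ^ 2 ≤ q.2 ∧ q.2 ≤ 1}

/-- The weight `W_{β,γ,μ}` on the solid paraboloid. -/
def WW (d : ℕ) (β γ μ : ℝ) (q : Euc d × ℝ) : ℝ :=
  q.2 ^ β * (1 - q.2) ^ γ * (q.2 - ‖q.1‖ ^ 2) ^ (μ - 1/2)

/-- Normalization constant `b_{β,γ,μ}`. -/
def bW (d : ℕ) (β γ μ : ℝ) : ℝ := (∫ q in Vset d, WW d β γ μ q)⁻¹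

/-- The weighted measure `W_{β,γ,μ}(x,t) dx dt` on `𝕍^{d+1}`. -/
def μW (d : ℕ) (β γ μ : ℝ) : Measure (Euc d × ℝ) :=
  (volume.restrict (Vset d)).withDensity fun q => ENNReal.ofReal (WW d β γ μ q)

/-- The weight `ϖ_μ(y) = (1-‖y‖²)^{μ-1/2}` on the unit ball. -/
def wB (d : ℕ) (μ : ℝ) (y : Euc d) : ℝ := (1 - ‖y‖ ^ 2) ^ (μ - 1/2)

/-- Normalization constant `b_μ` of `ϖ_μ` on the unit ball. -/
def bB (d : ℕ) (μ : ℝ) : ℝ := (∫ y in Metric.closedBall (0 : Euc d) 1, wB d μ y)⁻¹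

/-- Normalization constant `σ_μ = (∫_{-1}^1 (1-u²)^{μ-1} du)⁻¹`. -/
def σμ (μ : ℝ) : ℝ := (∫ u in (-1:ℝ)..1, (1 - u ^ 2) ^ (μ - 1))⁻¹

/-- `ξ₀(x,t,y,s;u) = (⟨x,y⟩ + u √(t-‖x‖²) √(s-‖y‖²))/√(st)`. -/
def xi0 (d : ℕ) (x : Euc d) (t : ℝ) (y : Euc d) (s : ℝ) (u : ℝ) : ℝ :=
  (⟪x, y⟫ + u * Real.sqrt (t - ‖x‖ ^ 2) * Real.sqrt (s - ‖y‖ ^ 2)) / Real.sqrt (s * t)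

/-- Squared norms `h_{m,n}^{β,γ,μ}` on the solid paraboloid. -/
def hW (d : ℕ) (β γ μ : ℝ) (m n : ℕ) : ℝ :=
  (cJ (β + μ + ((d : ℝ) - 1) / 2) γ / cJ ((m : ℝ) + β + μ + ((d : ℝ) - 1) / 2) γ) *
    hJ (n - m) ((m : ℝ) + β + μ + ((d : ℝ) - 1) / 2) γ

/-- The reproducing kernel `P_n(W_{β,γ,μ}; (x,t), (y,s))` on the solid paraboloid. -/
def PnW (d : ℕ) (β γ μ : ℝ) (n : ℕ) (x : Euc d) (t : ℝ) (y : Euc d) (s : ℝ) : ℝ :=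
  σμ μ * ∫ u in (-1:ℝ)..1,
    (∑ m ∈ Finset.range (n + 1),
      jacobiP (n - m) ((m : ℝ) + β + μ + ((d : ℝ) - 1) / 2) γ (1 - 2 * t) *
        jacobiP (n - m) ((m : ℝ) + β + μ + ((d : ℝ) - 1) / 2) γ (1 - 2 * s) / hW d β γ μ m n *
        (Real.sqrt t) ^ m * (Real.sqrt s) ^ m *
        Zm (μ + ((d : ℝ) - 1) / 2) m (xi0 d x t y s u)) * (1 - u ^ 2) ^ (μ - 1)

/-- Partial-sum kernel `K_n(W_{β,γ,μ})`. -/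
def KnW (d : ℕ) (β γ μ : ℝ) (n : ℕ) (x : Euc d) (t : ℝ) (y : Euc d) (s : ℝ) : ℝ :=
  ∑ m ∈ Finset.range (n + 1), PnW d β γ μ m x t y s

/-- Cesàro `(C,δ)` kernel on the solid paraboloid. -/
def KnWCes (d : ℕ) (β γ μ δ : ℝ) (n : ℕ) (x : Euc d) (t : ℝ) (y : Euc d) (s : ℝ) : ℝ :=
  (binomC δ n)⁻¹ * ∑ m ∈ Finset.range (n + 1), binomC (δ - 1) (n - m) * KnW d β γ μ m x t y s

/-- Cesàro `(C,δ)` means `S_n^δ(W_{β,γ,μ}; f, (x,t))`. -/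
def SnWCes (d : ℕ) (β γ μ δ : ℝ) (n : ℕ) (f : Euc d × ℝ → ℝ) (x : Euc d) (t : ℝ) : ℝ :=
  bW d β γ μ * ∫ q in Vset d, f q * KnWCes d β γ μ δ n x t q.1 q.2 * WW d β γ μ q

/-- `ξ(x,t,y,s;z,u)` in the connection kernel on the solid paraboloid. -/
def ξW (d : ℕ) (x : Euc d) (t : ℝ) (y : Euc d) (s : ℝ) (z₁ z₂ u : ℝ) : ℝ :=
  (1 - z₁) / 2 * xi0 d x t y s u + (1 + z₁) / 2 * z₂

/-- Normalization constant `κ_β`. -/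
def κβ (d : ℕ) (β μ : ℝ) : ℝ :=
  (∫ z₁ in (-1:ℝ)..1, ∫ z₂ in (-1:ℝ)..1, ∫ u in (-1:ℝ)..1,
    (1 - z₁) ^ (μ + ((d : ℝ) - 1) / 2) * (1 + z₁) ^ (β - 1) * (1 - z₂ ^ 2) ^ (β - 1/2) *
      (1 - u ^ 2) ^ (μ - 1))⁻¹

/-- The operator `T_{β,γ,μ}` on the solid paraboloid. -/
def TW (d : ℕ) (β γ μ : ℝ) (g : ℝ × ℝ → ℝ × ℝ → ℝ) (x : Euc d) (t : ℝ) (y : Euc d) (s : ℝ) : ℝ :=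
  if β = 0 then
    σμ μ * ∫ u in (-1:ℝ)..1,
      g (Real.sqrt t, t) (Real.sqrt s * xi0 d x t y s u, s) * (1 - u ^ 2) ^ (μ - 1)
  else
    κβ d β μ * ∫ z₁ in (-1:ℝ)..1, ∫ z₂ in (-1:ℝ)..1, ∫ u in (-1:ℝ)..1,
      g (Real.sqrt t, t) (Real.sqrt s * ξW d x t y s z₁ z₂ u, s) *
        ((1 - z₁) ^ (μ + ((d : ℝ) - 1) / 2) * (1 + z₁) ^ (β - 1) * (1 - z₂ ^ 2) ^ (β - 1/2) *
          (1 - u ^ 2) ^ (μ - 1))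

/-- Directional derivative `⟨x,∇⟩f(x) = ∑ xᵢ ∂ᵢ f(x)`. -/
def xGrad (d : ℕ) (f : Euc d → ℝ) (x : Euc d) : ℝ := fderiv ℝ f x x

/-- Laplacian `Δf(x) = ∑ ∂ᵢ² f(x)`. -/
def lapl (d : ℕ) (f : Euc d → ℝ) (x : Euc d) : ℝ :=
  ∑ i : Fin d, fderiv ℝ (fun y => fderiv ℝ f y (EuclideanSpace.single i 1)) x
    (EuclideanSpace.single i 1)


/-- `Q_{m,n}(x,t) = P_{n-m}^{(m+α,γ)}(1-2t) t^{m/2} Y(x/√t)`. -/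
def QV0gen (d : ℕ) (α γ : ℝ) (m n : ℕ) (Y : Euc d → ℝ) (x : Euc d) (t : ℝ) : ℝ :=
  jacobiP (n - m) ((m : ℝ) + α) γ (1 - 2 * t) * (Real.sqrt t) ^ m * Y ((Real.sqrt t)⁻¹ • x)

end


/-- truncated power -/
noncomputable def KK (e R : ℝ) : ℝ≥0∞ := if 0 < R then ENNReal.ofReal (R ^ e) else 0

theorem KK_meas (e : ℝ) : Measurable (KK e) := by
  unfold KK
  refine Measurable.ite (measurableSet_lt measurable_const measurable_id) ?_ measurable_const
  fun_prop

theorem KK_meas' {α : Type*} [MeasurableSpace α] (e : ℝ) {f : α → ℝ} (hf : Measurable f) :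
    Measurable (fun a => KK e (f a)) := (KK_meas e).comp hf

theorem KK_pos {e R : ℝ} (h : 0 < R) : KK e R = ENNReal.ofReal (R ^ e) := by simp [KK, h]

theorem KK_neg {e R : ℝ} (h : R ≤ 0) : KK e R = 0 := by simp [KK, not_lt.2 h]

theorem KK_mul (e : ℝ) {a : ℝ} (ha : 0 < a) (R : ℝ) :
    KK e (a * R) = ENNReal.ofReal (a ^ e) * KK e R := by
  rcases lt_or_ge 0 R with h | h
  · rw [KK_pos h, KK_pos (mul_pos ha h), Real.mul_rpow ha.le h.le, ENNReal.ofReal_mul (by positivity)]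
  · rw [KK_neg h, KK_neg (by nlinarith)]; simp

theorem lint_affine {f : ℝ → ℝ≥0∞} (hf : Measurable f) {a : ℝ} (ha : 0 < a) (b : ℝ) :
    ∫⁻ x, f (a * x + b) = ENNReal.ofReal a⁻¹ * ∫⁻ x, f x := by
  have h1 : ∫⁻ x, f (a * x + b) = ∫⁻ y, f (y + b) ∂(Measure.map (a * ·) volume) := by
    rw [lintegral_map (by fun_prop) (by fun_prop)]
  rw [h1, Real.map_volume_mul_left ha.ne', lintegral_smul_measure,
    lintegral_add_right_eq_self (μ := volume) f b, abs_of_pos (inv_pos.2 ha)]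
  rfl

/-- `∫_0^m R^e` -/
theorem lint_pow {e : ℝ} (he : -1 < e) {m : ℝ} (hm : 0 < m) :
    ∫⁻ x, (if x ≤ m then KK e x else 0) = ENNReal.ofReal (m ^ (e + 1) / (e + 1)) := by
  have h1 : ∫⁻ x, (if x ≤ m then KK e x else 0) = ∫⁻ x in Ioc 0 m, ENNReal.ofReal (x ^ e) := by
    rw [← lintegral_indicator measurableSet_Ioc]
    congr 1; ext x
    by_cases h0 : 0 < x <;> by_cases h2 : x ≤ m <;> simp [KK, h0, h2]
  have hi := (intervalIntegral.intervalIntegrable_rpow' (a := 0) (b := m) he)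
  rw [h1, ← ofReal_integral_eq_lintegral_ofReal]
  · rw [← intervalIntegral.integral_of_le hm.le, integral_rpow (Or.inl he),
      Real.zero_rpow (by linarith)]; simp
  · exact (intervalIntegrable_iff_integrableOn_Ioc_of_le hm.le).1 hi
  · filter_upwards [ae_restrict_mem measurableSet_Ioc] with x hx
    have := hx.1
    positivity

theorem lint_beta {a b : ℝ} (ha : -1 < a) (hb : -1 < b) :
    ∫⁻ z, KK a (1 - z) * KK b (1 + z) < ∞ := by
  let Fa : ℝ → ℝ≥0∞ := fun x => if x ≤ 1 then KK a x else 0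
  let Fb : ℝ → ℝ≥0∞ := fun x => if x ≤ 1 then KK b x else 0
  have hFa : Measurable Fa := Measurable.ite measurableSet_Iic (KK_meas a) measurable_const
  have hFb : Measurable Fb := Measurable.ite measurableSet_Iic (KK_meas b) measurable_const
  have key : ∀ {e x : ℝ}, 1 ≤ x → x ≤ 2 → KK e x ≤ ENNReal.ofReal (1 + 2 ^ e) := by
    intro e x h1 h2
    rw [KK_pos (by linarith)]
    apply ENNReal.ofReal_le_ofReal
    rcases le_total 0 e with he | he
    · have := Real.rpow_le_rpow (by linarith) h2 he
      linarith
    · have := Real.rpow_le_one_of_one_le_of_nonpos h1 he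
      have : (0:ℝ) < 2 ^ e := by positivity
      linarith
  have hle : ∀ z : ℝ, KK a (1 - z) * KK b (1 + z) ≤
      Fa (1 - z) * ENNReal.ofReal (1 + 2 ^ b) + ENNReal.ofReal (1 + 2 ^ a) * Fb (1 * z + 1) := by
    intro z
    rcases le_or_gt 1 z with h | h
    · rw [KK_neg (by linarith : 1 - z ≤ 0)]; simp
    rcases le_or_gt z (-1) with h' | h'
    · rw [KK_neg (by linarith : 1 + z ≤ 0)]; simp
    rcases le_total 0 z with h0 | h0
    · refine le_trans ?_ le_self_add
      have : Fa (1 - z) = KK a (1 - z) := if_pos (by linarith)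
      rw [this]
      gcongr
      exact key (by linarith) (by linarith)
    · refine le_trans ?_ le_add_self
      have : Fb (1 * z + 1) = KK b (1 + z) := by
        rw [one_mul, add_comm]; exact if_pos (by linarith)
      rw [this]
      gcongr
      exact key (by linarith) (by linarith)
  refine (lintegral_mono hle).trans_lt ?_
  rw [lintegral_add_left (by fun_prop), lintegral_mul_const _ (by fun_prop),
    lintegral_const_mul _ (by fun_prop), lintegral_sub_left_eq_self Fa 1,
    lint_affine hFb one_pos]
  simp only [Fa, Fb]
  rw [lint_pow ha one_pos, lint_pow hb one_pos]
  exact ENNReal.add_lt_top.2 ⟨by finiteness, by finiteness⟩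

theorem KK_one_sub_sq (e z : ℝ) : KK e (1 - z ^ 2) = KK e (1 - z) * KK e (1 + z) := by
  rcases le_or_gt 1 z with h | h
  · rw [KK_neg (by nlinarith), KK_neg (by linarith : 1 - z ≤ 0)]; simp
  · have := KK_mul e (by linarith : 0 < 1 - z) (1 + z)
    rw [KK_pos (by linarith : 0 < 1 - z), ← this]; congr 1; ring

theorem lint_sq {e : ℝ} (he : -1 < e) : ∫⁻ z, KK e (1 - z ^ 2) < ∞ := by
  simp_rw [KK_one_sub_sq]
  exact lint_beta he he

theorem lint_trunc {β : ℝ} (hβ : 0 < β) : ∃ C : ℝ≥0∞, C < ∞ ∧ ∀ m : ℝ, 0 < m →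
    ∫⁻ z, (if 1 + z ≤ m then KK (-(1/2)) (1 - z) * KK (β - 1) (1 + z) else 0) ≤
      C * ENNReal.ofReal (m ^ β) := by
  refine ⟨ENNReal.ofReal (1 / β) + ∫⁻ z, KK (-(1/2)) (1 - z) * KK (β - 1) (1 + z),
    ENNReal.add_lt_top.2 ⟨by finiteness, lint_beta (by norm_num) (by linarith)⟩, ?_⟩
  intro m hm
  have h1 : ∀ z : ℝ, (if 1 + z ≤ m then KK (-(1/2)) (1 - z) * KK (β - 1) (1 + z) else 0) ≤
      (fun x => if x ≤ m then KK (β - 1) x else 0) (1 * z + 1) +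
      ENNReal.ofReal (m ^ β) * (KK (-(1/2)) (1 - z) * KK (β - 1) (1 + z)) := by
    intro z
    simp only [one_mul, add_comm z 1]
    split_ifs with h
    · rcases le_or_gt z 0 with h0 | h0
      · refine le_trans ?_ le_self_add
        calc _ ≤ 1 * KK (β - 1) (1 + z) := by
              gcongr
              rw [KK_pos (by linarith)]
              rw [← ENNReal.ofReal_one]
              apply ENNReal.ofReal_le_ofReal
              exact Real.rpow_le_one_of_one_le_of_nonpos (by linarith) (by norm_num)
          _ = _ := one_mul _
      · refine le_trans ?_ le_add_self
        calc _ = 1 * (KK (-(1/2)) (1 - z) * KK (β - 1) (1 + z)) := (one_mul _).symm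
          _ ≤ _ := by
            gcongr
            rw [← ENNReal.ofReal_one]
            exact ENNReal.ofReal_le_ofReal (Real.one_le_rpow (by linarith) hβ.le)
    · exact zero_le
  have hm1 : Measurable (fun x => if x ≤ m then KK (β - 1) x else 0) :=
    Measurable.ite measurableSet_Iic (KK_meas _) measurable_const
  have hm2 : Measurable (fun z => KK (-(1/2)) (1 - z) * KK (β - 1) (1 + z)) :=
    (KK_meas' _ (by fun_prop)).mul (KK_meas' _ (by fun_prop))
  refine (lintegral_mono h1).trans ?_
  rw [lintegral_add_right _ (hm2.const_mul _), lintegral_const_mul _ hm2,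
    lint_affine hm1 one_pos, lint_pow (by linarith) hm, add_mul, mul_comm (ENNReal.ofReal (m ^ β))]
  refine add_le_add ?_ le_rfl
  rw [← ENNReal.ofReal_mul (by positivity), ← ENNReal.ofReal_mul (by positivity)]
  apply ENNReal.ofReal_le_ofReal
  simp
  rw [div_eq_inv_mul]

theorem lint_ball (d : ℕ) (hd : 2 ≤ d) {μ : ℝ} (hμ : 0 < μ) : ∃ C : ℝ≥0∞, C < ∞ ∧ ∀ R : ℝ,
    ∫⁻ y : Euc d, KK (μ - 1) (R - ‖y‖ ^ 2) ≤ C * KK (μ - 1 + (d : ℝ) / 2) R := by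
  refine ⟨∫⁻ y : Euc d, KK (μ - 1) (1 - ‖y‖ ^ 2), ?_, ?_⟩
  · have : Nontrivial (Euc d) := by
      have : Nonempty (Fin d) := ⟨⟨0, by omega⟩⟩
      infer_instance
    have hfin := lint_sq (e := μ - 1) (by linarith)
    let f : ℝ → ℝ := fun r => (KK (μ - 1) (1 - r ^ 2)).toReal
    have hne : ∀ R, KK (μ - 1) R ≠ ∞ := by
      intro R; unfold KK; split_ifs <;> simp
    have hfm : Measurable f := (KK_meas' _ (by fun_prop)).ennreal_toReal
    have hf1 : Integrable f := by
      refine ⟨hfm.aestronglyMeasurable, ?_⟩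
      unfold HasFiniteIntegral
      refine lt_of_eq_of_lt ?_ hfin
      congr 1; ext z
      simp only [f]
      rw [Real.enorm_eq_ofReal ENNReal.toReal_nonneg, ENNReal.ofReal_toReal (hne _)]
    have hf2 : Integrable (fun y : Euc d => f ‖y‖) := by
      rw [integrable_fun_norm_addHaar]
      refine Integrable.mono hf1.integrableOn ?_ ?_
      · exact ((measurable_id.pow_const _).smul hfm).aestronglyMeasurable
      · filter_upwards [ae_restrict_mem measurableSet_Ioi] with r hr
        have hr : 0 < r := hr
        rw [norm_smul, norm_pow, Real.norm_of_nonneg hr.le]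
        rcases le_or_gt r 1 with h | h
        · exact mul_le_of_le_one_left (norm_nonneg _) (pow_le_one₀ hr.le h)
        · have : f r = 0 := by
            simp only [f]; rw [KK_neg (by nlinarith)]; simp
          simp [this]
    have h3 := hf2.2
    unfold HasFiniteIntegral at h3
    refine lt_of_eq_of_lt ?_ h3
    congr 1; ext z
    simp only [f]
    rw [Real.enorm_eq_ofReal ENNReal.toReal_nonneg, ENNReal.ofReal_toReal (hne _)]
  · intro R
    rcases le_or_gt R 0 with hR | hR
    · have : ∀ y : Euc d, KK (μ - 1) (R - ‖y‖ ^ 2) = 0 := fun y =>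
        KK_neg (by nlinarith [sq_nonneg ‖y‖])
      simp [this]
    · have hs : 0 < √R := Real.sqrt_pos.2 hR
      have hmm : Measurable (fun y : Euc d => KK (μ - 1) (R - ‖y‖ ^ 2)) :=
        KK_meas' _ (by fun_prop)
      have h1 : ∫⁻ y : Euc d, KK (μ - 1) (R - ‖√R • y‖ ^ 2) =
          ENNReal.ofReal (√R ^ d)⁻¹ * ∫⁻ y : Euc d, KK (μ - 1) (R - ‖y‖ ^ 2) := by
        have : ∫⁻ y : Euc d, KK (μ - 1) (R - ‖√R • y‖ ^ 2) =
          ∫⁻ y, KK (μ - 1) (R - ‖y‖ ^ 2) ∂(Measure.map (√R • ·) (volume : Measure (Euc d))) := by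
          rw [lintegral_map hmm (by fun_prop)]
        rw [this, Measure.map_addHaar_smul _ hs.ne', lintegral_smul_measure]
        simp [abs_of_pos hs]
      have h2 : ∀ y : Euc d, KK (μ - 1) (R - ‖√R • y‖ ^ 2) =
          ENNReal.ofReal (R ^ (μ - 1)) * KK (μ - 1) (1 - ‖y‖ ^ 2) := by
        intro y
        rw [← KK_mul _ hR]
        congr 1
        rw [norm_smul, Real.norm_of_nonneg hs.le, mul_pow, Real.sq_sqrt hR.le]; ring
      simp_rw [h2] at h1
      rw [lintegral_const_mul _ (KK_meas' _ (by fun_prop))] at h1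
      have h4 : ENNReal.ofReal (√R ^ d) * ENNReal.ofReal (√R ^ d)⁻¹ = 1 := by
        rw [← ENNReal.ofReal_mul (by positivity), mul_inv_cancel₀ (by positivity)]; simp
      apply le_of_eq
      calc _ = ENNReal.ofReal (√R ^ d) * (ENNReal.ofReal (√R ^ d)⁻¹ *
            ∫⁻ y : Euc d, KK (μ - 1) (R - ‖y‖ ^ 2)) := by rw [← mul_assoc, h4, one_mul]
        _ = _ := by
          rw [← h1, ← mul_assoc, ← ENNReal.ofReal_mul (by positivity), mul_comm, KK_pos hR]
          congr 2
          rw [Real.rpow_add hR, mul_comm]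
          congr 1
          rw [Real.sqrt_eq_rpow, ← Real.rpow_natCast, ← Real.rpow_mul hR.le]
          congr 1; ring

theorem rot_lint (d : ℕ) (a : Euc d) (b : ℝ) (hb : 0 ≤ b) (hab : ‖a‖ ^ 2 + b ^ 2 = 1)
    (h k : ℝ → ℝ≥0∞) (hh : Measurable h) (hk : Measurable k) :
    ∫⁻ y : Euc d, ∫⁻ w : ℝ, h (⟪a, y⟫ + b * w) * k (‖y‖ ^ 2 + w ^ 2) =
    ∫⁻ v : ℝ, ∫⁻ y : Euc d, h v * k (‖y‖ ^ 2 + v ^ 2) := by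
  have hb1 : 1 + b ≠ 0 := by positivity
  let L : (Euc d × ℝ) →ₗ[ℝ] (Euc d × ℝ) :=
    { toFun := fun Y => (Y.1 - (Y.2 + ⟪a, Y.1⟫ / (1 + b)) • a, -⟪a, Y.1⟫ - b * Y.2)
      map_add' := by
        intro Y Z
        ext1
        · simp only [Prod.fst_add, Prod.snd_add, inner_add_right]
          module
        · simp only [Prod.fst_add, Prod.snd_add, inner_add_right]
          ring
      map_smul' := by
        intro c Y
        ext1
        · simp only [Prod.smul_fst, Prod.smul_snd, inner_smul_right, smul_eq_mul, RingHom.id_apply]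
          module
        · simp only [Prod.smul_fst, Prod.smul_snd, inner_smul_right, smul_eq_mul, RingHom.id_apply]
          ring }
  have hL : ∀ Y, L Y = (Y.1 - (Y.2 + ⟪a, Y.1⟫ / (1 + b)) • a, -⟪a, Y.1⟫ - b * Y.2) := fun _ => rfl
  have haa : ⟪a, a⟫ = (1 - b) * (1 + b) := by
    rw [real_inner_self_eq_norm_sq]; linarith
  have hin : ∀ Y : Euc d × ℝ, ⟪a, (L Y).1⟫ = b * ⟪a, Y.1⟫ - (1 - b ^ 2) * Y.2 := by
    intro Y
    rw [hL, inner_sub_right, inner_smul_right, haa]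
    field_simp; ring
  have hLL : L ∘ₗ L = LinearMap.id := by
    apply LinearMap.ext
    intro Y
    rw [LinearMap.comp_apply, LinearMap.id_apply, hL (L Y), hin]
    ext1
    · simp only [hL]
      rw [sub_sub, ← add_smul]
      have : Y.2 + ⟪a, Y.1⟫ / (1 + b) + (-⟪a, Y.1⟫ - b * Y.2 +
        (b * ⟪a, Y.1⟫ - (1 - b ^ 2) * Y.2) / (1 + b)) = 0 := by
        field_simp; ring
      rw [this]; simp
    · simp only [hL]; ring
  have hnorm : ∀ Y : Euc d × ℝ, ‖(L Y).1‖ ^ 2 + (L Y).2 ^ 2 = ‖Y.1‖ ^ 2 + Y.2 ^ 2 := by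
    intro Y
    simp only [hL]
    rw [@norm_sub_sq_real, norm_smul, mul_pow, Real.norm_eq_abs, sq_abs, inner_smul_right,
      real_inner_comm, ← real_inner_self_eq_norm_sq a, haa]
    field_simp; ring
  have hdet : LinearMap.det L * LinearMap.det L = 1 := by
    rw [← LinearMap.det_comp, hLL, LinearMap.det_id]
  have hdet0 : LinearMap.det L ≠ 0 := by
    intro h0; rw [h0] at hdet; simp at hdet
  have habs : |(LinearMap.det L)⁻¹| = 1 := by
    rcases mul_self_eq_one_iff.1 hdet with h1 | h1 <;> rw [h1] <;> norm_num
  have hmap : Measure.map L (volume : Measure (Euc d × ℝ)) = volume := by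
    have : (volume : Measure (Euc d × ℝ)).IsAddHaarMeasure := by
      rw [Measure.volume_eq_prod]; infer_instance
    rw [Measure.map_linearMap_addHaar_eq_smul_addHaar _ hdet0, habs]; simp
  have hLm : Measurable L := L.continuous_of_finiteDimensional.measurable
  let F : Euc d × ℝ → ℝ≥0∞ := fun Y => h (-Y.2) * k (‖Y.1‖ ^ 2 + Y.2 ^ 2)
  have hF : Measurable F := by
    refine (hh.comp (by fun_prop)).mul (hk.comp (by fun_prop))
  have hm1 : Measurable (fun Y : Euc d × ℝ => h (⟪a, Y.1⟫ + b * Y.2) * k (‖Y.1‖ ^ 2 + Y.2 ^ 2)) := by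
    refine (hh.comp (by fun_prop)).mul (hk.comp (by fun_prop))
  calc _ = ∫⁻ Y : Euc d × ℝ, h (⟪a, Y.1⟫ + b * Y.2) * k (‖Y.1‖ ^ 2 + Y.2 ^ 2) := by
        rw [Measure.volume_eq_prod, lintegral_prod _ hm1.aemeasurable]
    _ = ∫⁻ Y, F (L Y) := by
        congr 1; ext Y
        simp only [F]
        rw [hnorm]
        congr 2
        simp only [hL]; ring
    _ = ∫⁻ Y, F Y := by
        rw [← lintegral_map hF hLm, hmap]
    _ = ∫⁻ v, ∫⁻ y, F (y, v) := by
        rw [Measure.volume_eq_prod, lintegral_prod_symm _ hF.aemeasurable]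
    _ = ∫⁻ v, (fun v => ∫⁻ y : Euc d, h v * k (‖y‖ ^ 2 + v ^ 2)) (-v) := by
        simp [F]
    _ = _ := by
        have := lintegral_sub_left_eq_self (μ := (volume : Measure ℝ))
          (fun v => ∫⁻ y : Euc d, h v * k (‖y‖ ^ 2 + v ^ 2)) 0
        simp only [zero_sub] at this
        exact this

theorem lemA (d : ℕ) (hd : 2 ≤ d) {μ : ℝ} (hμ : 0 < μ) : ∃ C : ℝ≥0∞, C < ∞ ∧
    ∀ (h : ℝ → ℝ≥0∞), Measurable h → ∀ (x : Euc d) (t s : ℝ), 0 < t → ‖x‖ ^ 2 ≤ t →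
    ∫⁻ y : Euc d, ∫⁻ u : ℝ, h ((⟪x, y⟫ + u * √(t - ‖x‖ ^ 2) * √(s - ‖y‖ ^ 2)) / √t) *
      (KK (μ - 1) (1 - u ^ 2) * KK (μ - 1/2) (s - ‖y‖ ^ 2)) ≤
    C * ∫⁻ v : ℝ, h v * KK (μ - 1 + (d : ℝ) / 2) (s - v ^ 2) := by
  obtain ⟨C, hC, hball⟩ := lint_ball d hd hμ
  refine ⟨C, hC, ?_⟩
  intro h hh x t s ht hx
  have hst : 0 < √t := Real.sqrt_pos.2 ht
  set a : Euc d := (√t)⁻¹ • x with ha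
  set b : ℝ := √(t - ‖x‖ ^ 2) / √t with hb
  have hb0 : 0 ≤ b := by positivity
  have hab : ‖a‖ ^ 2 + b ^ 2 = 1 := by
    rw [ha, hb, norm_smul, mul_pow, div_pow, Real.sq_sqrt (by linarith), Real.sq_sqrt ht.le,
      norm_inv, Real.norm_of_nonneg hst.le, inv_pow, Real.sq_sqrt ht.le]
    field_simp; ring
  have hkm : Measurable (fun q => KK (μ - 1) (s - q)) := KK_meas' _ (by fun_prop)
  have hrot := rot_lint d a b hb0 hab h (fun q => KK (μ - 1) (s - q)) hh hkm
  have step1 : ∀ y : Euc d, ∫⁻ u : ℝ, h ((⟪x, y⟫ + u * √(t - ‖x‖ ^ 2) * √(s - ‖y‖ ^ 2)) / √t) *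
      (KK (μ - 1) (1 - u ^ 2) * KK (μ - 1/2) (s - ‖y‖ ^ 2)) ≤
      ∫⁻ w : ℝ, h (⟪a, y⟫ + b * w) * KK (μ - 1) (s - (‖y‖ ^ 2 + w ^ 2)) := by
    intro y
    rcases le_or_gt (s - ‖y‖ ^ 2) 0 with h0 | h0
    · rw [KK_neg h0]; simp
    · set ρ := √(s - ‖y‖ ^ 2) with hρ
      have hρ0 : 0 < ρ := Real.sqrt_pos.2 h0
      have hρ2 : ρ ^ 2 = s - ‖y‖ ^ 2 := Real.sq_sqrt h0.le
      have hm : Measurable (fun w => h (⟪a, y⟫ + b * w) * KK (μ - 1) (s - (‖y‖ ^ 2 + w ^ 2))) :=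
        (hh.comp (by fun_prop)).mul (KK_meas' _ (by fun_prop))
      have := lint_affine hm hρ0 0
      have hc : ENNReal.ofReal ρ * ENNReal.ofReal ρ⁻¹ = 1 := by
        rw [← ENNReal.ofReal_mul hρ0.le, mul_inv_cancel₀ hρ0.ne']; simp
      have e1 : ∫⁻ w : ℝ, h (⟪a, y⟫ + b * w) * KK (μ - 1) (s - (‖y‖ ^ 2 + w ^ 2)) =
          ENNReal.ofReal ρ * ∫⁻ u : ℝ, h (⟪a, y⟫ + b * (ρ * u + 0)) *
            KK (μ - 1) (s - (‖y‖ ^ 2 + (ρ * u + 0) ^ 2)) := by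
        rw [this, ← mul_assoc, hc, one_mul]
      rw [e1, ← lintegral_const_mul' _ _ ENNReal.ofReal_ne_top]
      apply le_of_eq
      congr 1; ext u
      have e2 : (⟪x, y⟫ + u * √(t - ‖x‖ ^ 2) * ρ) / √t = ⟪a, y⟫ + b * (ρ * u + 0) := by
        rw [ha, hb, real_inner_smul_left]; field_simp; ring
      have e3 : s - (‖y‖ ^ 2 + (ρ * u + 0) ^ 2) = ρ ^ 2 * (1 - u ^ 2) := by
        rw [hρ2, add_zero, mul_pow, hρ2]; ring
      rw [e2, e3, KK_mul _ (by positivity), ← hρ2, KK_pos (R := ρ ^ 2) (by positivity)]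
      have e4 : ENNReal.ofReal ((ρ ^ 2) ^ (μ - 1/2)) =
          ENNReal.ofReal ρ * ENNReal.ofReal ((ρ ^ 2) ^ (μ - 1)) := by
        rw [← ENNReal.ofReal_mul hρ0.le]
        congr 1
        have : ρ = (ρ ^ 2) ^ ((1:ℝ)/2) := by
          rw [← Real.sqrt_eq_rpow, Real.sqrt_sq hρ0.le]
        nth_rewrite 2 [this]
        rw [← Real.rpow_add (by positivity)]
        congr 1; ring
      rw [e4]; ring
  refine (lintegral_mono step1).trans ?_
  rw [hrot, ← lintegral_const_mul' _ _ hC.ne]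
  refine lintegral_mono fun v => ?_
  simp only
  rw [lintegral_const_mul _ (KK_meas' _ (by fun_prop))]
  have := hball (s - v ^ 2)
  calc _ = h v * ∫⁻ y : Euc d, KK (μ - 1) (s - v ^ 2 - ‖y‖ ^ 2) := by
        congr 2; ext y; congr 1; ring
    _ ≤ h v * (C * KK (μ - 1 + (d : ℝ) / 2) (s - v ^ 2)) := by gcongr
    _ = _ := by ring

theorem geomB {s v z r : ℝ} (hs : 0 < s) (hv : 0 < s - v ^ 2) (hz1 : -1 < z) (hz2 : z < 1)
    (hr0 : 0 < r) (hr1 : r < 1) {p : ℝ} (hp : p = r * v + (1 - r) * (√s * z)) :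
    r * (s - v ^ 2) ≤ 2 * (s - p ^ 2) ∧ (1 - r) * (1 - z ^ 2) * s ≤ 2 * (s - p ^ 2) ∧
      0 < s - p ^ 2 := by
  set S := √s with hS
  have hS0 : 0 < S := Real.sqrt_pos.2 hs
  have hS2 : S ^ 2 = s := Real.sq_sqrt hs.le
  have hvS : |v| < S := abs_lt_of_sq_lt_sq (by linarith) hS0.le
  have hzz : |z| < 1 := abs_lt.2 ⟨hz1, hz2⟩
  have hpp : |p| ≤ r * |v| + (1 - r) * (S * |z|) := by
    rw [hp]
    refine (abs_add_le _ _).trans (le_of_eq ?_)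
    rw [abs_mul, abs_mul, abs_mul, abs_of_pos hr0, abs_of_pos (by linarith : 0 < 1 - r),
      abs_of_pos hS0]
  have h1 : r * (S - |v|) + (1 - r) * (S * (1 - |z|)) ≤ S - |p| := by linarith
  have a1 : 0 < r * (S - |v|) := mul_pos hr0 (by linarith)
  have a2 : 0 < (1 - r) * (S * (1 - |z|)) :=
    mul_pos (by linarith) (mul_pos hS0 (by linarith))
  have hpS : |p| < S := by linarith
  have hp0 := abs_nonneg p
  have hv0 := abs_nonneg v
  have hz0 := abs_nonneg z
  have h2 : S * (S - |p|) ≤ s - p ^ 2 := by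
    rw [← sq_abs p]; nlinarith
  refine ⟨?_, ?_, ?_⟩
  · have e : s - v ^ 2 ≤ 2 * S * (S - |v|) := by rw [← sq_abs v]; nlinarith
    have e' : r * (s - v ^ 2) ≤ 2 * S * (r * (S - |v|)) := by nlinarith
    have e'' : 2 * S * (r * (S - |v|)) ≤ 2 * S * (S - |p|) := by
      apply mul_le_mul_of_nonneg_left _ (by positivity); linarith
    linarith
  · have e : 1 - z ^ 2 ≤ 2 * (1 - |z|) := by rw [← sq_abs z]; nlinarith
    have e' : (1 - r) * (1 - z ^ 2) * s ≤ (1 - r) * (2 * (1 - |z|)) * s := by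
      apply mul_le_mul_of_nonneg_right _ hs.le
      exact mul_le_mul_of_nonneg_left e (by linarith)
    have e'' : 2 * S * ((1 - r) * (S * (1 - |z|))) ≤ 2 * S * (S - |p|) := by
      apply mul_le_mul_of_nonneg_left _ (by positivity); linarith
    have e3 : (1 - r) * (2 * (1 - |z|)) * s = 2 * S * ((1 - r) * (S * (1 - |z|))) := by
      rw [← hS2]; ring
    linarith
  · have : 0 < S * (S - |p|) := mul_pos hS0 (by linarith)
    linarith

/-- auxiliary kernel -/
noncomputable def MB (lam β s p z₁ z₂ : ℝ) : ℝ≥0∞ :=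
  ENNReal.ofReal (2 * 4 ^ (lam - 1/2)) * KK (lam - 1/2) (s - p ^ 2) *
    (KK (β - 1/2) (1 - z₂ ^ 2) * ENNReal.ofReal (s ^ β)) *
    (if 1 + z₁ ≤ 4 * (s - p ^ 2) / (s * (1 - z₂ ^ 2)) then
      KK (-(1/2)) (1 - z₁) * KK (β - 1) (1 + z₁) else 0)

theorem MB_meas (lam β s : ℝ) :
    Measurable (fun q : ℝ × ℝ × ℝ => MB lam β s q.1 q.2.1 q.2.2) := by
  unfold MB
  refine Measurable.mul (Measurable.mul (Measurable.mul measurable_const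
    (KK_meas' _ (by fun_prop))) (Measurable.mul (KK_meas' _ (by fun_prop)) measurable_const)) ?_
  refine Measurable.ite (measurableSet_le (by fun_prop) (by fun_prop)) ?_ measurable_const
  exact (KK_meas' _ (by fun_prop)).mul (KK_meas' _ (by fun_prop))

theorem MB_int {β : ℝ} (lam : ℝ) (hβ : 0 < β) : ∃ C : ℝ≥0∞, C < ∞ ∧ ∀ s p : ℝ, 0 < s →
    ∫⁻ z₂, ∫⁻ z₁, MB lam β s p z₁ z₂ ≤ C * KK (lam + β - 1/2) (s - p ^ 2) := by
  obtain ⟨C, hC, hF⟩ := lint_trunc hβ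
  have hfin := lint_sq (e := -(1/2)) (by norm_num)
  refine ⟨ENNReal.ofReal (2 * 4 ^ (lam - 1/2)) * C * ENNReal.ofReal (4 ^ β) *
    ∫⁻ z, KK (-(1/2)) (1 - z ^ 2), by finiteness, ?_⟩
  intro s p hs
  rcases le_or_gt (s - p ^ 2) 0 with hQ | hQ
  · have : ∀ z₁ z₂, MB lam β s p z₁ z₂ = 0 := by
      intro z₁ z₂; unfold MB; rw [KK_neg hQ]; simp
    simp [this]
  set Q := s - p ^ 2 with hQdef
  have hz : ∀ z₂, ∫⁻ z₁, MB lam β s p z₁ z₂ ≤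
      ENNReal.ofReal (2 * 4 ^ (lam - 1/2)) * C * ENNReal.ofReal (4 ^ β) *
        KK (lam + β - 1/2) Q * KK (-(1/2)) (1 - z₂ ^ 2) := by
    intro z₂
    rcases le_or_gt (1 - z₂ ^ 2) 0 with hX | hX
    · have : ∀ z₁, MB lam β s p z₁ z₂ = 0 := by
        intro z₁; unfold MB; rw [KK_neg hX]; simp
      simp [this]
    set X := 1 - z₂ ^ 2 with hXdef
    have hm : 0 < 4 * Q / (s * X) := by positivity
    unfold MB
    rw [← hQdef, ← hXdef, lintegral_const_mul']
    swap
    · rw [KK_pos hQ, KK_pos hX]; finiteness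
    refine (mul_le_mul_right (hF _ hm) _).trans (le_of_eq ?_)
    rw [KK_pos hQ, KK_pos hX, KK_pos hQ, KK_pos hX]
    have e : ENNReal.ofReal (Q ^ (lam - 1/2)) * (ENNReal.ofReal (X ^ (β - 1/2)) *
        ENNReal.ofReal (s ^ β)) * ENNReal.ofReal ((4 * Q / (s * X)) ^ β) =
        ENNReal.ofReal (4 ^ β) * ENNReal.ofReal (Q ^ (lam + β - 1/2)) *
          ENNReal.ofReal (X ^ (-(1/2) : ℝ)) := by
      rw [← ENNReal.ofReal_mul (by positivity), ← ENNReal.ofReal_mul (by positivity),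
        ← ENNReal.ofReal_mul (by positivity), ← ENNReal.ofReal_mul (by positivity),
        ← ENNReal.ofReal_mul (by positivity)]
      congr 1
      rw [Real.div_rpow (by positivity) (by positivity), Real.mul_rpow (by positivity) hQ.le,
        Real.mul_rpow hs.le hX.le]
      have e1 : Q ^ (lam + β - 1/2) = Q ^ (lam - 1/2) * Q ^ β := by
        rw [← Real.rpow_add hQ]; congr 1; ring
      have e2 : X ^ (β - 1/2) = X ^ (-(1/2) : ℝ) * X ^ β := by
        rw [← Real.rpow_add hX]; congr 1; ring
      rw [e1, e2]
      have := Real.rpow_pos_of_pos hs β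
      have := Real.rpow_pos_of_pos hX β
      field_simp
    calc _ = ENNReal.ofReal (2 * 4 ^ (lam - 1/2)) * C * (ENNReal.ofReal (Q ^ (lam - 1/2)) *
        (ENNReal.ofReal (X ^ (β - 1/2)) *
        ENNReal.ofReal (s ^ β)) * ENNReal.ofReal ((4 * Q / (s * X)) ^ β)) := by ring
      _ = _ := by rw [e]; ring
  refine (lintegral_mono hz).trans (le_of_eq ?_)
  rw [lintegral_const_mul' _ _ (by rw [KK_pos hQ]; finiteness)]
  ring

theorem MB_bound {lam β s : ℝ} (hl : 1/2 ≤ lam) (hs : 0 < s) {h : ℝ → ℝ≥0∞}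
    (hh : Measurable h) (z₁ z₂ : ℝ) :
    (∫⁻ v, h ((1 - z₁) / 2 * v + (1 + z₁) / 2 * (√s * z₂)) * KK (lam - 1/2) (s - v ^ 2)) *
      (KK lam (1 - z₁) * KK (β - 1) (1 + z₁) * KK (β - 1/2) (1 - z₂ ^ 2) * ENNReal.ofReal (s ^ β))
    ≤ ∫⁻ p, h p * MB lam β s p z₁ z₂ := by
  rcases le_or_gt 1 z₁ with c1 | c1
  · rw [KK_neg (by linarith : 1 - z₁ ≤ 0)]; simp
  rcases le_or_gt z₁ (-1) with c2 | c2
  · rw [KK_neg (by linarith : 1 + z₁ ≤ 0)]; simp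
  rcases le_or_gt (1 - z₂ ^ 2) 0 with c3 | c3
  · rw [KK_neg c3]; simp
  have hz1 : -1 < z₂ := by nlinarith
  have hz2 : z₂ < 1 := by nlinarith
  set r := (1 - z₁) / 2 with hr
  have hr0 : 0 < r := by linarith
  have hr1 : r < 1 := by linarith
  have h1r : (1 + z₁) / 2 = 1 - r := by rw [hr]; ring
  set c := (1 + z₁) / 2 * (√s * z₂) with hc
  have hm : Measurable (fun p => h p * KK (lam - 1/2) (s - ((p - c) / r) ^ 2)) :=
    hh.mul (KK_meas' _ (by fun_prop))
  have e1 : ∫⁻ v, h (r * v + c) * KK (lam - 1/2) (s - v ^ 2) =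
      ENNReal.ofReal r⁻¹ * ∫⁻ p, h p * KK (lam - 1/2) (s - ((p - c) / r) ^ 2) := by
    rw [← lint_affine hm hr0 c]
    congr 1; ext v
    congr 3
    field_simp
    ring
  rw [e1, mul_right_comm, mul_comm, ← lintegral_mul_const' _ _ (by
    rw [KK_pos (by linarith), KK_pos (by linarith), KK_pos c3]; finiteness)]
  refine lintegral_mono fun p => ?_
  simp only
  rw [mul_assoc]
  refine mul_le_mul_right ?_ _
  set v := (p - c) / r with hv
  rcases le_or_gt (s - v ^ 2) 0 with c4 | c4
  · rw [KK_neg c4]; simp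
  have hp : p = r * v + (1 - r) * (√s * z₂) := by
    rw [← h1r, ← hc, hv]; field_simp; ring
  obtain ⟨g1, g2, g3⟩ := geomB hs c4 hz1 hz2 hr0 hr1 hp
  unfold MB
  rw [if_pos]
  swap
  · rw [le_div_iff₀ (by positivity)]
    have : 1 + z₁ = 2 * (1 - r) := by linarith
    rw [this]; linarith
  set Q := s - p ^ 2 with hQ
  have hq : 0 < 1 - z₁ := by linarith
  have real_ineq : (s - v ^ 2) ^ (lam - 1/2) * (r⁻¹ * (1 - z₁) ^ lam) ≤
      2 * 4 ^ (lam - 1/2) * Q ^ (lam - 1/2) * (1 - z₁) ^ (-(1/2) : ℝ) := by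
    have k1 : s - v ^ 2 ≤ 4 * Q / (1 - z₁) := by
      rw [le_div_iff₀ hq]
      have : 1 - z₁ = 2 * r := by linarith
      rw [this]; linarith
    have k2 := Real.rpow_le_rpow c4.le k1 (by linarith : 0 ≤ lam - 1/2)
    have k3 : (4 * Q / (1 - z₁)) ^ (lam - 1/2) * (r⁻¹ * (1 - z₁) ^ lam) =
        2 * 4 ^ (lam - 1/2) * Q ^ (lam - 1/2) * (1 - z₁) ^ (-(1/2) : ℝ) := by
      rw [Real.div_rpow (by positivity) hq.le, Real.mul_rpow (by norm_num) g3.le]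
      have k4 : (1 - z₁) ^ lam = (1 - z₁) ^ (lam - 1/2) * (1 - z₁) * (1 - z₁) ^ (-(1/2) : ℝ) := by
        nth_rewrite 3 [← Real.rpow_one (1 - z₁)]
        rw [← Real.rpow_add hq, ← Real.rpow_add hq]; congr 1; ring
      have k5 : r⁻¹ = 2 / (1 - z₁) := by rw [hr]; field_simp
      rw [k4, k5]
      have := Real.rpow_pos_of_pos hq (lam - 1/2)
      field_simp
    rw [← k3]
    have := Real.rpow_pos_of_pos hq lam
    exact mul_le_mul_of_nonneg_right k2 (by positivity)
  have enn : KK (lam - 1/2) (s - v ^ 2) * (ENNReal.ofReal r⁻¹ * KK lam (1 - z₁)) ≤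
      ENNReal.ofReal (2 * 4 ^ (lam - 1/2)) * KK (lam - 1/2) Q * KK (-(1/2)) (1 - z₁) := by
    rw [KK_pos c4, KK_pos hq, KK_pos hq, KK_pos g3, ← ENNReal.ofReal_mul (by positivity),
      ← ENNReal.ofReal_mul (by positivity), ← ENNReal.ofReal_mul (by positivity),
      ← ENNReal.ofReal_mul (by positivity)]
    exact ENNReal.ofReal_le_ofReal real_ineq
  calc _ = KK (lam - 1/2) (s - v ^ 2) * (ENNReal.ofReal r⁻¹ * KK lam (1 - z₁)) *
        (KK (β - 1) (1 + z₁) * KK (β - 1/2) (1 - z₂ ^ 2) * ENNReal.ofReal (s ^ β)) := by ring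
    _ ≤ ENNReal.ofReal (2 * 4 ^ (lam - 1/2)) * KK (lam - 1/2) Q * KK (-(1/2)) (1 - z₁) *
        (KK (β - 1) (1 + z₁) * KK (β - 1/2) (1 - z₂ ^ 2) * ENNReal.ofReal (s ^ β)) := by gcongr
    _ = _ := by ring

theorem lemB {lam β : ℝ} (hl : 1/2 ≤ lam) (hβ : 0 < β) : ∃ C : ℝ≥0∞, C < ∞ ∧
    ∀ (h : ℝ → ℝ≥0∞), Measurable h → ∀ s : ℝ, 0 < s →
    ∫⁻ z₁, ∫⁻ z₂,
    (∫⁻ v, h ((1 - z₁) / 2 * v + (1 + z₁) / 2 * (√s * z₂)) * KK (lam - 1/2) (s - v ^ 2)) *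
      (KK lam (1 - z₁) * KK (β - 1) (1 + z₁) * KK (β - 1/2) (1 - z₂ ^ 2) * ENNReal.ofReal (s ^ β))
    ≤ C * ∫⁻ p, h p * KK (lam + β - 1/2) (s - p ^ 2) := by
  obtain ⟨C, hC, hM⟩ := MB_int lam hβ
  refine ⟨C, hC, ?_⟩
  intro h hh s hs
  have hmeas : Measurable (fun q : ℝ × ℝ × ℝ => h q.1 * MB lam β s q.1 q.2.1 q.2.2) :=
    (hh.comp measurable_fst).mul (MB_meas lam β s)
  calc _ ≤ ∫⁻ z₁, ∫⁻ z₂, ∫⁻ p, h p * MB lam β s p z₁ z₂ :=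
        lintegral_mono fun z₁ => lintegral_mono fun z₂ => MB_bound hl hs hh z₁ z₂
    _ = ∫⁻ z₁, ∫⁻ p, ∫⁻ z₂, h p * MB lam β s p z₁ z₂ := by
        congr 1; ext z₁
        rw [lintegral_lintegral_swap]
        exact (hmeas.comp (g := fun q : ℝ × ℝ × ℝ => h q.1 * MB lam β s q.1 q.2.1 q.2.2)
          (f := fun q : ℝ × ℝ => (q.2, z₁, q.1)) (by fun_prop)).aemeasurable
    _ = ∫⁻ p, ∫⁻ z₁, ∫⁻ z₂, h p * MB lam β s p z₁ z₂ := by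
        rw [lintegral_lintegral_swap]
        refine Measurable.aemeasurable ?_
        exact Measurable.lintegral_prod_right' (f := fun q : (ℝ × ℝ) × ℝ =>
          h q.1.2 * MB lam β s q.1.2 q.1.1 q.2)
          (hmeas.comp (g := fun q : ℝ × ℝ × ℝ => h q.1 * MB lam β s q.1 q.2.1 q.2.2)
          (f := fun q : (ℝ × ℝ) × ℝ => (q.1.2, q.1.1, q.2)) (by fun_prop))
    _ = ∫⁻ p, ∫⁻ z₂, ∫⁻ z₁, h p * MB lam β s p z₁ z₂ := by
        congr 1; ext p
        rw [lintegral_lintegral_swap]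
        exact (hmeas.comp (g := fun q : ℝ × ℝ × ℝ => h q.1 * MB lam β s q.1 q.2.1 q.2.2)
          (f := fun q : ℝ × ℝ => (p, q.1, q.2)) (by fun_prop)).aemeasurable
    _ = ∫⁻ p, h p * ∫⁻ z₂, ∫⁻ z₁, MB lam β s p z₁ z₂ := by
        congr 1; ext p
        rw [← lintegral_const_mul]
        · congr 1; ext z₂
          rw [lintegral_const_mul]
          exact (MB_meas lam β s).comp (f := fun z : ℝ => (p, z, z₂)) (by fun_prop)
        · exact Measurable.lintegral_prod_right' (f := fun q : ℝ × ℝ => MB lam β s p q.2 q.1)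
            ((MB_meas lam β s).comp (f := fun q : ℝ × ℝ => (p, q.2, q.1)) (by fun_prop))
    _ ≤ ∫⁻ p, C * (h p * KK (lam + β - 1/2) (s - p ^ 2)) := by
        refine lintegral_mono fun p => ?_
        calc _ ≤ h p * (C * KK (lam + β - 1/2) (s - p ^ 2)) := by gcongr; exact hM s p hs
          _ = _ := by ring
    _ = _ := lintegral_const_mul' _ _ hC.ne

theorem KK_ne_top (e R : ℝ) : KK e R ≠ ∞ := by
  unfold KK; split_ifs <;> simp

theorem enorm_interval_le {f : ℝ → ℝ} {F : ℝ → ℝ≥0∞}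
    (h : ∀ u, -1 < u → u < 1 → ‖f u‖ₑ ≤ F u) : ‖∫ u in (-1:ℝ)..1, f u‖ₑ ≤ ∫⁻ u, F u := by
  rw [intervalIntegral.integral_of_le (by norm_num), integral_Ioc_eq_integral_Ioo]
  refine (enorm_integral_le_lintegral_enorm _).trans ?_
  calc _ ≤ ∫⁻ u in Ioo (-1:ℝ) 1, F u :=
        setLIntegral_mono' measurableSet_Ioo fun u hu => h u hu.1 hu.2
    _ ≤ _ := setLIntegral_le_lintegral _ _

theorem xi0_eq (d : ℕ) (x : Euc d) (t : ℝ) (y : Euc d) {s : ℝ} (u : ℝ) (hs : 0 < s) :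
    √s * xi0 d x t y s u = (⟪x, y⟫ + u * √(t - ‖x‖ ^ 2) * √(s - ‖y‖ ^ 2)) / √t := by
  unfold xi0
  have : 0 < √s := Real.sqrt_pos.2 hs
  rw [Real.sqrt_mul hs.le, ← mul_div_assoc, mul_div_mul_left _ _ this.ne']

theorem ofReal_one_sub_sq (e : ℝ) {u : ℝ} (h1 : -1 < u) (h2 : u < 1) :
    ‖(1 - u ^ 2) ^ e‖ₑ = KK e (1 - u ^ 2) := by
  have : 0 < 1 - u ^ 2 := by nlinarith
  rw [KK_pos this, Real.enorm_eq_ofReal (by positivity)]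

theorem enorm_rpow_pos (e : ℝ) {u : ℝ} (h1 : 0 < u) : ‖u ^ e‖ₑ = KK e u := by
  rw [KK_pos h1, Real.enorm_eq_ofReal (by positivity)]

theorem TW_zero_le (d : ℕ) (γ μ : ℝ) (g : ℝ × ℝ → ℝ × ℝ → ℝ) (x y : Euc d) (t s : ℝ)
    (hs : 0 < s) :
    ‖TW d 0 γ μ g x t y s‖ₑ ≤ ‖σμ μ‖ₑ * ∫⁻ u,
      ‖g (√t, t) ((⟪x, y⟫ + u * √(t - ‖x‖ ^ 2) * √(s - ‖y‖ ^ 2)) / √t, s)‖ₑ *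
        KK (μ - 1) (1 - u ^ 2) := by
  unfold TW
  rw [if_pos rfl, enorm_mul]
  gcongr
  apply enorm_interval_le
  intro u h1 h2
  rw [enorm_mul, ofReal_one_sub_sq _ h1 h2, xi0_eq _ _ _ _ _ hs]

theorem TW_pos_le (d : ℕ) {β : ℝ} (hβ : β ≠ 0) (γ μ : ℝ) (g : ℝ × ℝ → ℝ × ℝ → ℝ) (x y : Euc d)
    (t s : ℝ) (hs : 0 < s) :
    ‖TW d β γ μ g x t y s‖ₑ ≤ ‖κβ d β μ‖ₑ * ∫⁻ z₁, ∫⁻ z₂, ∫⁻ u,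
      ‖g (√t, t) ((1 - z₁) / 2 * ((⟪x, y⟫ + u * √(t - ‖x‖ ^ 2) * √(s - ‖y‖ ^ 2)) / √t) +
        (1 + z₁) / 2 * (√s * z₂), s)‖ₑ *
        (KK (μ + ((d : ℝ) - 1) / 2) (1 - z₁) * KK (β - 1) (1 + z₁) * KK (β - 1/2) (1 - z₂ ^ 2) *
          KK (μ - 1) (1 - u ^ 2)) := by
  unfold TW
  rw [if_neg hβ, enorm_mul]
  gcongr
  apply enorm_interval_le
  intro z₁ h1 h2
  apply enorm_interval_le
  intro z₂ h3 h4
  apply enorm_interval_le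
  intro u h5 h6
  rw [enorm_mul, enorm_mul, enorm_mul, enorm_mul, ofReal_one_sub_sq _ h3 h4,
    ofReal_one_sub_sq _ h5 h6, enorm_rpow_pos _ (by linarith), enorm_rpow_pos _ (by linarith)]
  apply le_of_eq
  congr 4
  rw [← xi0_eq _ _ _ _ _ hs]
  unfold ξW
  ring_nf

theorem assemble (d : ℕ) (β γ μ a : ℝ) (g : ℝ × ℝ → ℝ × ℝ → ℝ) (x : Euc d) (t : ℝ)
    (hg : Measurable (fun z => g (√t, t) z))
    (hint : Integrable (fun z => g (√t, t) z) (μU γ a))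
    (I : Euc d × ℝ → ℝ≥0∞) (hI : Measurable I) (A C : ℝ≥0∞) (hA : A < ∞) (hC : C < ∞)
    (h1 : ∀ y s, 0 < s → ‖TW d β γ μ g x t y s‖ₑ ≤ A * I (y, s))
    (h2 : ∀ s, 0 < s → ∫⁻ y : Euc d, I (y, s) * (KK (μ - 1/2) (s - ‖y‖ ^ 2) *
        ENNReal.ofReal (s ^ β)) ≤
      C * ∫⁻ p, ‖g (√t, t) (p, s)‖ₑ * KK (a - 1/2) (s - p ^ 2)) :
    (∫ q in Vset d, |TW d β γ μ g x t q.1 q.2| * WW d β γ μ q) ≤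
          ((A * C).toReal + 1) * ∫ z in Udom, |g (√t, t) z| * Uw γ a z := by
  have hUm : MeasurableSet Udom := by
    have e : Udom = {x : ℝ × ℝ | x.1 ^ 2 ≤ x.2} ∩ {x : ℝ × ℝ | x.2 ≤ 1} := rfl
    rw [e]
    exact (measurableSet_le (by fun_prop) (by fun_prop)).inter
      (measurableSet_le (by fun_prop) (by fun_prop))
  have hVm : MeasurableSet (Vset d) := by
    have e : Vset d = {q : Euc d × ℝ | ‖q.1‖ ^ 2 ≤ q.2} ∩ {q : Euc d × ℝ | q.2 ≤ 1} := rfl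
    rw [e]
    exact (measurableSet_le (by fun_prop) (by fun_prop)).inter
      (measurableSet_le (by fun_prop) (by fun_prop))
  have hUwm : Measurable (Uw γ a) := by unfold Uw; fun_prop
  have hUw0 : ∀ z ∈ Udom, 0 ≤ Uw γ a z := by
    intro z hz
    exact mul_nonneg (Real.rpow_nonneg (by linarith [hz.2]) _)
      (Real.rpow_nonneg (by linarith [hz.1]) _)
  -- right-hand side
  set R : ℝ≥0∞ := ∫⁻ z in Udom, ‖g (√t, t) z‖ₑ * ENNReal.ofReal (Uw γ a z) with hR
  have hRfin : R < ∞ := by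
    have := hint.2
    unfold HasFiniteIntegral μU at this
    rw [lintegral_withDensity_eq_lintegral_mul _ (by fun_prop) (by fun_prop)] at this
    refine lt_of_eq_of_lt ?_ this
    rw [hR]; congr 1; ext z; simp [mul_comm]
  have hRHS : ∫ z in Udom, |g (√t, t) z| * Uw γ a z = R.toReal := by
    rw [integral_eq_lintegral_of_nonneg_ae]
    · congr 1
      refine setLIntegral_congr_fun hUm fun z hz => ?_
      rw [ENNReal.ofReal_mul (abs_nonneg _), Real.enorm_eq_ofReal_abs]
    · filter_upwards [ae_restrict_mem hUm] with z hz
      exact mul_nonneg (abs_nonneg _) (hUw0 z hz)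
    · have : Measurable (fun z => |g (√t, t) z| * Uw γ a z) := by
        have := hg.abs
        fun_prop
      exact this.aestronglyMeasurable
  -- slice weight
  let w : ℝ → ℝ≥0∞ := fun s => if s ≤ 1 then ENNReal.ofReal ((1 - s) ^ γ) else 0
  have hw : Measurable w := Measurable.ite measurableSet_Iic (by fun_prop) measurable_const
  have hwne : ∀ s, w s ≠ ∞ := by intro s; simp only [w]; split_ifs <;> simp
  have hgK : Measurable (fun z : ℝ × ℝ => w z.2 * (‖g (√t, t) z‖ₑ * KK (a - 1/2) (z.2 - z.1 ^ 2))) :=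
    (hw.comp measurable_snd).mul (hg.enorm.mul (KK_meas' _ (by fun_prop)))
  have hRlow : ∫⁻ s, w s * ∫⁻ p, ‖g (√t, t) (p, s)‖ₑ * KK (a - 1/2) (s - p ^ 2) ≤ R := by
    calc _ = ∫⁻ s, ∫⁻ p, w s * (‖g (√t, t) (p, s)‖ₑ * KK (a - 1/2) (s - p ^ 2)) := by
          congr 1; ext s; rw [lintegral_const_mul' _ _ (hwne s)]
      _ = ∫⁻ z : ℝ × ℝ, w z.2 * (‖g (√t, t) z‖ₑ * KK (a - 1/2) (z.2 - z.1 ^ 2)) := by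
          rw [Measure.volume_eq_prod, lintegral_prod_symm _ hgK.aemeasurable]
      _ ≤ R := by
          rw [hR, ← lintegral_indicator hUm]
          refine lintegral_mono fun z => ?_
          simp only [w]
          split_ifs with c1
          · rcases le_or_gt (z.2 - z.1 ^ 2) 0 with c2 | c2
            · rw [KK_neg c2]; simp
            · have hz : z ∈ Udom := ⟨by linarith, c1⟩
              rw [indicator_of_mem hz, KK_pos c2]
              apply le_of_eq
              unfold Uw
              rw [ENNReal.ofReal_mul (Real.rpow_nonneg (by linarith) _)]
              ring
          · simp
  -- left-hand side
  let H : Euc d × ℝ → ℝ≥0∞ := fun q =>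
    w q.2 * (I q * (KK (μ - 1/2) (q.2 - ‖q.1‖ ^ 2) * ENNReal.ofReal (q.2 ^ β)))
  have hH : Measurable H :=
    (hw.comp measurable_snd).mul (hI.mul ((KK_meas' _ (by fun_prop)).mul (by fun_prop)))
  have hnull : ∀ᵐ q : Euc d × ℝ, ‖q.1‖ ^ 2 ≠ q.2 := by
    rw [ae_iff]
    have hms : MeasurableSet {q : Euc d × ℝ | ¬ ‖q.1‖ ^ 2 ≠ q.2} := by
      simp only [not_not]
      exact measurableSet_eq_fun (by fun_prop) (by fun_prop)
    rw [Measure.volume_eq_prod, Measure.measure_prod_null hms]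
    filter_upwards with y
    have : (Prod.mk y ⁻¹' {q : Euc d × ℝ | ¬ ‖q.1‖ ^ 2 ≠ q.2}) = {‖y‖ ^ 2} := by
      ext s; simp [eq_comm]
    rw [this]; simp
  have hL : ∫⁻ q in Vset d, ‖|TW d β γ μ g x t q.1 q.2| * WW d β γ μ q‖ₑ ≤ A * C * R := by
    calc _ ≤ ∫⁻ q, A * H q := by
          rw [← lintegral_indicator hVm]
          refine lintegral_mono_ae ?_
          filter_upwards [hnull] with q hq
          by_cases hqV : q ∈ Vset d
          · rw [indicator_of_mem hqV]
            obtain ⟨v1, v2⟩ := hqV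
            have v3 : 0 < q.2 - ‖q.1‖ ^ 2 := by
              have := lt_of_le_of_ne v1 hq; linarith
            have v4 : 0 < q.2 := by nlinarith [sq_nonneg ‖q.1‖]
            have v5 : 0 ≤ (1 - q.2) ^ γ := Real.rpow_nonneg (by linarith) _
            rw [enorm_mul, Real.enorm_abs]
            have e : ‖WW d β γ μ q‖ₑ = w q.2 *
                (KK (μ - 1/2) (q.2 - ‖q.1‖ ^ 2) * ENNReal.ofReal (q.2 ^ β)) := by
              unfold WW
              rw [enorm_mul, enorm_mul, enorm_rpow_pos _ v3, Real.enorm_eq_ofReal (by positivity),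
                Real.enorm_eq_ofReal v5]
              simp only [w]
              rw [if_pos v2]
              ring
            rw [e]
            calc _ ≤ A * I (q.1, q.2) * (w q.2 *
                (KK (μ - 1/2) (q.2 - ‖q.1‖ ^ 2) * ENNReal.ofReal (q.2 ^ β))) := by
                  gcongr; exact h1 _ _ v4
              _ = _ := by simp only [H]; ring
          · rw [indicator_of_notMem hqV]; exact zero_le
      _ = A * ∫⁻ s, ∫⁻ y, H (y, s) := by
          rw [lintegral_const_mul' _ _ hA.ne, Measure.volume_eq_prod,
            lintegral_prod_symm _ hH.aemeasurable]
      _ ≤ A * ∫⁻ s, C * (w s * ∫⁻ p, ‖g (√t, t) (p, s)‖ₑ * KK (a - 1/2) (s - p ^ 2)) := by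
          gcongr with s
          simp only [H]
          rw [lintegral_const_mul' _ _ (hwne s)]
          rcases le_or_gt s 0 with c | c
          · have : ∀ y : Euc d, KK (μ - 1/2) (s - ‖y‖ ^ 2) = 0 := fun y =>
              KK_neg (by nlinarith [sq_nonneg ‖y‖])
            simp only [this, zero_mul, mul_zero, lintegral_zero]; exact zero_le
          · calc _ ≤ w s * (C * ∫⁻ p, ‖g (√t, t) (p, s)‖ₑ * KK (a - 1/2) (s - p ^ 2)) := by
                  gcongr; exact h2 s c
              _ = _ := by ring
      _ = A * C * ∫⁻ s, w s * ∫⁻ p, ‖g (√t, t) (p, s)‖ₑ * KK (a - 1/2) (s - p ^ 2) := by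
          rw [lintegral_const_mul' _ _ hC.ne, mul_assoc]
      _ ≤ _ := by gcongr
  rw [hRHS]
  have hACR : A * C * R < ∞ := by finiteness
  have f1 := (enorm_integral_le_lintegral_enorm
    (μ := volume.restrict (Vset d)) (fun q => |TW d β γ μ g x t q.1 q.2| * WW d β γ μ q)).trans hL
  have f2 := ENNReal.toReal_mono hACR.ne f1
  rw [ENNReal.toReal_mul, toReal_enorm] at f2
  calc _ ≤ _ := Real.le_norm_self _
    _ ≤ _ := f2
    _ ≤ _ := by
      have : 0 ≤ R.toReal := ENNReal.toReal_nonneg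
      nlinarith

theorem meas_zeta (d : ℕ) (x : Euc d) (t : ℝ) : Measurable (fun q : Euc d × ℝ × ℝ =>
    (⟪x, q.1⟫ + q.2.2 * √(t - ‖x‖ ^ 2) * √(q.2.1 - ‖q.1‖ ^ 2)) / √t) := by
  fun_prop

theorem caseZero (d : ℕ) (hd : 2 ≤ d) (γ μ : ℝ) (hμ : 0 < μ) :
    ∃ c : ℝ, 0 < c ∧ ∀ g : ℝ × ℝ → ℝ × ℝ → ℝ, Measurable (Function.uncurry g) →
      (∀ t ∈ Set.Icc (0:ℝ) 1,
        Integrable (fun z => g (Real.sqrt t, t) z) (μU γ (0 + μ + ((d : ℝ) - 1)/2))) →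
      ∀ (x : Euc d) (t : ℝ), (x, t) ∈ Vset d → 0 < t →
        (∫ q in Vset d, |TW d 0 γ μ g x t q.1 q.2| * WW d 0 γ μ q) ≤
          c * ∫ z in Udom, |g (Real.sqrt t, t) z| * Uw γ (0 + μ + ((d : ℝ) - 1)/2) z := by
  obtain ⟨C, hC, hA⟩ := lemA d hd hμ
  refine ⟨(‖σμ μ‖ₑ * C).toReal + 1, by positivity, ?_⟩
  intro g hg hint x t hxt ht
  have hgt : Measurable (fun z => g (√t, t) z) := hg.comp (f := fun z => ((√t, t), z)) (by fun_prop)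
  refine assemble d 0 γ μ _ g x t hgt (hint t ⟨ht.le, hxt.2⟩)
    (fun q => ∫⁻ u, ‖g (√t, t) ((⟪x, q.1⟫ + u * √(t - ‖x‖ ^ 2) * √(q.2 - ‖q.1‖ ^ 2)) / √t, q.2)‖ₑ *
        KK (μ - 1) (1 - u ^ 2)) ?_ _ C (by finiteness) hC
    (fun y s hs => TW_zero_le d γ μ g x y t s hs) ?_
  · refine Measurable.lintegral_prod_right' (f := fun p : (Euc d × ℝ) × ℝ =>
      ‖g (√t, t) ((⟪x, p.1.1⟫ + p.2 * √(t - ‖x‖ ^ 2) * √(p.1.2 - ‖p.1.1‖ ^ 2)) / √t, p.1.2)‖ₑ *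
        KK (μ - 1) (1 - p.2 ^ 2)) ?_
    exact (hgt.comp (by fun_prop)).enorm.mul (KK_meas' _ (by fun_prop))
  · intro s hs
    have := hA (fun v => ‖g (√t, t) (v, s)‖ₑ) (hgt.comp (by fun_prop)).enorm x t s ht hxt.1
    refine le_trans (le_of_eq ?_) (this.trans (le_of_eq ?_))
    · congr 1; ext y
      rw [← lintegral_mul_const' _ _ (ENNReal.mul_ne_top (KK_ne_top _ _) ENNReal.ofReal_ne_top)]
      congr 1; ext u
      simp only [Real.rpow_zero, ENNReal.ofReal_one]
      ring
    · congr 4; ext v; congr 2; ring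

theorem casePos (d : ℕ) (hd : 2 ≤ d) (β γ μ : ℝ) (hβ : 0 < β) (hμ : 0 < μ) :
    ∃ c : ℝ, 0 < c ∧ ∀ g : ℝ × ℝ → ℝ × ℝ → ℝ, Measurable (Function.uncurry g) →
      (∀ t ∈ Set.Icc (0:ℝ) 1,
        Integrable (fun z => g (Real.sqrt t, t) z) (μU γ (β + μ + ((d : ℝ) - 1)/2))) →
      ∀ (x : Euc d) (t : ℝ), (x, t) ∈ Vset d → 0 < t →
        (∫ q in Vset d, |TW d β γ μ g x t q.1 q.2| * WW d β γ μ q) ≤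
          c * ∫ z in Udom, |g (Real.sqrt t, t) z| * Uw γ (β + μ + ((d : ℝ) - 1)/2) z := by
  obtain ⟨C, hC, hA⟩ := lemA d hd hμ
  have hd' : (2:ℝ) ≤ d := by exact_mod_cast hd
  set lam := μ + ((d : ℝ) - 1) / 2 with hlam
  obtain ⟨C', hC', hB⟩ := lemB (lam := lam) (by rw [hlam]; linarith) hβ
  refine ⟨(‖κβ d β μ‖ₑ * (C * C')).toReal + 1, by positivity, ?_⟩
  intro g hg hint x t hxt ht
  have hgt : Measurable (fun z => g (√t, t) z) := hg.comp (f := fun z => ((√t, t), z)) (by fun_prop)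
  refine assemble d β γ μ _ g x t hgt (hint t ⟨ht.le, hxt.2⟩)
    (fun q => ∫⁻ z₁, ∫⁻ z₂, ∫⁻ u,
      ‖g (√t, t) ((1 - z₁) / 2 * ((⟪x, q.1⟫ + u * √(t - ‖x‖ ^ 2) * √(q.2 - ‖q.1‖ ^ 2)) / √t) +
        (1 + z₁) / 2 * (√q.2 * z₂), q.2)‖ₑ *
        (KK lam (1 - z₁) * KK (β - 1) (1 + z₁) * KK (β - 1/2) (1 - z₂ ^ 2) *
          KK (μ - 1) (1 - u ^ 2))) ?_ _ (C * C') (by finiteness) (by finiteness)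
    (fun y s hs => TW_pos_le d hβ.ne' γ μ g x y t s hs) ?_
  · refine Measurable.lintegral_prod_right' (f := fun p : (Euc d × ℝ) × ℝ =>
      ∫⁻ z₂, ∫⁻ u,
      ‖g (√t, t) ((1 - p.2) / 2 * ((⟪x, p.1.1⟫ + u * √(t - ‖x‖ ^ 2) * √(p.1.2 - ‖p.1.1‖ ^ 2)) / √t) +
        (1 + p.2) / 2 * (√p.1.2 * z₂), p.1.2)‖ₑ *
        (KK lam (1 - p.2) * KK (β - 1) (1 + p.2) * KK (β - 1/2) (1 - z₂ ^ 2) *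
          KK (μ - 1) (1 - u ^ 2))) ?_
    refine Measurable.lintegral_prod_right' (f := fun p : ((Euc d × ℝ) × ℝ) × ℝ =>
      ∫⁻ u,
      ‖g (√t, t) ((1 - p.1.2) / 2 * ((⟪x, p.1.1.1⟫ + u * √(t - ‖x‖ ^ 2) *
        √(p.1.1.2 - ‖p.1.1.1‖ ^ 2)) / √t) + (1 + p.1.2) / 2 * (√p.1.1.2 * p.2), p.1.1.2)‖ₑ *
        (KK lam (1 - p.1.2) * KK (β - 1) (1 + p.1.2) * KK (β - 1/2) (1 - p.2 ^ 2) *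
          KK (μ - 1) (1 - u ^ 2))) ?_
    refine Measurable.lintegral_prod_right' (f := fun p : (((Euc d × ℝ) × ℝ) × ℝ) × ℝ =>
      ‖g (√t, t) ((1 - p.1.1.2) / 2 * ((⟪x, p.1.1.1.1⟫ + p.2 * √(t - ‖x‖ ^ 2) *
        √(p.1.1.1.2 - ‖p.1.1.1.1‖ ^ 2)) / √t) + (1 + p.1.1.2) / 2 * (√p.1.1.1.2 * p.1.2),
          p.1.1.1.2)‖ₑ *
        (KK lam (1 - p.1.1.2) * KK (β - 1) (1 + p.1.1.2) * KK (β - 1/2) (1 - p.1.2 ^ 2) *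
          KK (μ - 1) (1 - p.2 ^ 2))) ?_
    exact (hgt.comp (by fun_prop)).enorm.mul ((((KK_meas' _ (by fun_prop)).mul
      (KK_meas' _ (by fun_prop))).mul (KK_meas' _ (by fun_prop))).mul (KK_meas' _ (by fun_prop)))
  · intro s hs
    let cst : ℝ → ℝ → ℝ≥0∞ := fun z₁ z₂ => KK lam (1 - z₁) * KK (β - 1) (1 + z₁) *
      KK (β - 1/2) (1 - z₂ ^ 2) * ENNReal.ofReal (s ^ β)
    have hcne : ∀ z₁ z₂, cst z₁ z₂ ≠ ∞ := fun z₁ z₂ =>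
      ENNReal.mul_ne_top (ENNReal.mul_ne_top (ENNReal.mul_ne_top (KK_ne_top _ _) (KK_ne_top _ _))
        (KK_ne_top _ _)) ENNReal.ofReal_ne_top
    have hcm : Measurable (fun z : ℝ × ℝ => cst z.1 z.2) :=
      (((KK_meas' _ (by fun_prop)).mul (KK_meas' _ (by fun_prop))).mul
        (KK_meas' _ (by fun_prop))).mul measurable_const
    let hz : ℝ → ℝ → ℝ → ℝ≥0∞ := fun z₁ z₂ v =>
      ‖g (√t, t) ((1 - z₁) / 2 * v + (1 + z₁) / 2 * (√s * z₂), s)‖ₑ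
    let ζ : Euc d → ℝ → ℝ := fun y u => (⟪x, y⟫ + u * √(t - ‖x‖ ^ 2) * √(s - ‖y‖ ^ 2)) / √t
    let J : Euc d → ℝ → ℝ → ℝ≥0∞ := fun y z₁ z₂ => ∫⁻ u, hz z₁ z₂ (ζ y u) *
      (KK (μ - 1) (1 - u ^ 2) * KK (μ - 1/2) (s - ‖y‖ ^ 2))
    have hJ : Measurable (fun p : Euc d × ℝ × ℝ => J p.1 p.2.1 p.2.2) := by
      refine Measurable.lintegral_prod_right' (f := fun p : (Euc d × ℝ × ℝ) × ℝ =>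
        hz p.1.2.1 p.1.2.2 (ζ p.1.1 p.2) *
          (KK (μ - 1) (1 - p.2 ^ 2) * KK (μ - 1/2) (s - ‖p.1.1‖ ^ 2))) ?_
      exact (hgt.comp (by fun_prop)).enorm.mul ((KK_meas' _ (by fun_prop)).mul
        (KK_meas' _ (by fun_prop)))
    have hJc : Measurable (fun p : Euc d × ℝ × ℝ => J p.1 p.2.1 p.2.2 * cst p.2.1 p.2.2) :=
      hJ.mul (hcm.comp (f := fun p : Euc d × ℝ × ℝ => (p.2.1, p.2.2)) (by fun_prop))
    calc _ = ∫⁻ y, ∫⁻ z₁, ∫⁻ z₂, J y z₁ z₂ * cst z₁ z₂ := by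
          have hk : ∀ y : Euc d, KK (μ - 1/2) (s - ‖y‖ ^ 2) * ENNReal.ofReal (s ^ β) ≠ ∞ :=
            fun y => ENNReal.mul_ne_top (KK_ne_top _ _) ENNReal.ofReal_ne_top
          congr 1; ext y
          rw [← lintegral_mul_const' _ _ (hk y)]
          congr 1; ext z₁
          rw [← lintegral_mul_const' _ _ (hk y)]
          congr 1; ext z₂
          rw [← lintegral_mul_const' _ _ (hk y)]
          simp only [J]
          rw [← lintegral_mul_const' _ _ (hcne _ _)]
          congr 1; ext u
          simp only [hz, ζ, cst]
          ring
      _ = ∫⁻ z₁, ∫⁻ y, ∫⁻ z₂, J y z₁ z₂ * cst z₁ z₂ := by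
          rw [lintegral_lintegral_swap]
          refine Measurable.aemeasurable ?_
          exact Measurable.lintegral_prod_right' (f := fun q : (Euc d × ℝ) × ℝ =>
            J q.1.1 q.1.2 q.2 * cst q.1.2 q.2)
            (hJc.comp (f := fun q : (Euc d × ℝ) × ℝ => (q.1.1, q.1.2, q.2)) (by fun_prop))
      _ = ∫⁻ z₁, ∫⁻ z₂, ∫⁻ y, J y z₁ z₂ * cst z₁ z₂ := by
          congr 1; ext z₁
          rw [lintegral_lintegral_swap]
          exact (hJc.comp (f := fun q : Euc d × ℝ => (q.1, z₁, q.2)) (by fun_prop)).aemeasurable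
      _ = ∫⁻ z₁, ∫⁻ z₂, (∫⁻ y, J y z₁ z₂) * cst z₁ z₂ := by
          congr 1; ext z₁; congr 1; ext z₂
          rw [lintegral_mul_const' _ _ (hcne _ _)]
      _ ≤ ∫⁻ z₁, ∫⁻ z₂, C * ((∫⁻ v, hz z₁ z₂ v * KK (lam - 1/2) (s - v ^ 2)) * cst z₁ z₂) := by
          refine lintegral_mono fun z₁ => lintegral_mono fun z₂ => ?_
          have := hA (hz z₁ z₂) (hgt.comp (by fun_prop)).enorm x t s ht hxt.1
          have e : μ - 1 + (d : ℝ) / 2 = lam - 1/2 := by rw [hlam]; ring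
          rw [e] at this
          calc _ ≤ (C * ∫⁻ v, hz z₁ z₂ v * KK (lam - 1/2) (s - v ^ 2)) * cst z₁ z₂ := by gcongr
            _ = _ := by ring
      _ = C * ∫⁻ z₁, ∫⁻ z₂, (∫⁻ v, hz z₁ z₂ v * KK (lam - 1/2) (s - v ^ 2)) * cst z₁ z₂ := by
          rw [← lintegral_const_mul' _ _ hC.ne]
          congr 1; ext z₁
          rw [← lintegral_const_mul' _ _ hC.ne]
      _ ≤ C * (C' * ∫⁻ p, ‖g (√t, t) (p, s)‖ₑ * KK (lam + β - 1/2) (s - p ^ 2)) := by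
          gcongr
          exact hB (fun p => ‖g (√t, t) (p, s)‖ₑ) (hgt.comp (by fun_prop)).enorm s hs
      _ = _ := by
          have e : lam + β - 1/2 = β + μ + ((d : ℝ) - 1)/2 - 1/2 := by rw [hlam]; ring
          rw [e, mul_assoc]



/-- `L¹` boundedness of the operator `T_{β,γ,μ}` on the solid paraboloid. -/
theorem stmt19 (d : ℕ) (hd : 2 ≤ d) (β γ μ : ℝ) (hβ : 0 ≤ β) (hμ : 0 < μ) (hγ : -1 < γ) :
    ∃ c : ℝ, 0 < c ∧ ∀ g : ℝ × ℝ → ℝ × ℝ → ℝ, Measurable (Function.uncurry g) →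
      (∀ t ∈ Set.Icc (0:ℝ) 1,
        Integrable (fun z => g (Real.sqrt t, t) z) (μU γ (β + μ + ((d : ℝ) - 1)/2))) →
      ∀ (x : Euc d) (t : ℝ), (x, t) ∈ Vset d → 0 < t →
        (∫ q in Vset d, |TW d β γ μ g x t q.1 q.2| * WW d β γ μ q) ≤
          c * ∫ z in Udom, |g (Real.sqrt t, t) z| * Uw γ (β + μ + ((d : ℝ) - 1)/2) z := by
  rcases hβ.eq_or_lt with h0 | h0
  · subst h0
    exact caseZero d hd γ μ hμ
  · exact casePos d hd β γ μ h0 hμ
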